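/- arXiv:2504.17969 — 3 statements merged into one kernel-verified Lean document; each statement's English description precedes it below -/
import Mathlib

section
/- Let m_x, m_u ≥ 1 and let f : ℝ^{m_x} × ℝ^{m_u} → ℝ^{m_x} be continuous. For each integer n ≥ 1, let x_n : [0,1] → ℝ^{m_x} be continuously differentiable and u_n : [0,1] → ℝ^{m_u} be continuous. Suppose there exist a continuously differentiable x^∞ : [0,1] → ℝ^{m_x} and a continuous u^∞ : [0,1] → ℝ^{m_u} such that x_n → x^∞, x_n′ → (x^∞)′, and u_n → u^∞ uniformly on [0,1]. Suppose also there are δ_n ≥ 0 with δ_n → 0 such that for every n ≥ 1 and every k ∈ {0, 1, …, n}, ‖x_n′(k/n) − f(x_n(k/n), u_n(k/n))‖ ≤ δ_n. Then (x^∞)′(t) = f(x^∞(t), u^∞(t)) for every t ∈ [0,1]. -/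
open Filter

/-- Uniformly convergent functions, evaluated at points converging within the set to a point of
continuity of the limit, converge to the value of the limit there. -/
theorem TendstoUniformlyOn.tendsto_comp_of_continuousWithinAt {α β ι : Type*}
    [TopologicalSpace α] [UniformSpace β] {F : ι → α → β} {f : α → β} {s : Set α} {a : α}
    {p : Filter ι} {g : ι → α} (h : TendstoUniformlyOn F f p s)
    (hf : ContinuousWithinAt f s a) (hg : Tendsto g p (nhdsWithin a s)) :
    Tendsto (fun n => F n (g n)) p (nhds (f a)) :=
  tendsto_comp_of_locally_uniform_limit_within hf hg
    fun v hv => ⟨s, self_mem_nhdsWithin, h v hv⟩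

/-- Consistency of the discretized dynamics: the uniform limit of discrete solutions
satisfying the relaxed dynamic constraints at the equidistant nodes `k/n` satisfies the
continuous-time dynamics everywhere on `[0,1]`. -/
theorem limit_satisfies_dynamics (mx mu : ℕ) (hmx : 1 ≤ mx) (hmu : 1 ≤ mu)
    (f : EuclideanSpace ℝ (Fin mx) → EuclideanSpace ℝ (Fin mu) → EuclideanSpace ℝ (Fin mx))
    (hf : Continuous fun q : EuclideanSpace ℝ (Fin mx) × EuclideanSpace ℝ (Fin mu) => f q.1 q.2)
    (x : ℕ → ℝ → EuclideanSpace ℝ (Fin mx)) (x' : ℕ → ℝ → EuclideanSpace ℝ (Fin mx))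
    (u : ℕ → ℝ → EuclideanSpace ℝ (Fin mu))
    (hx : ∀ n : ℕ, 1 ≤ n → ∀ t ∈ Set.Icc (0:ℝ) 1, HasDerivAt (x n) (x' n t) t)
    (hx'c : ∀ n : ℕ, 1 ≤ n → ContinuousOn (x' n) (Set.Icc 0 1))
    (huc : ∀ n : ℕ, 1 ≤ n → ContinuousOn (u n) (Set.Icc 0 1))
    (xinf : ℝ → EuclideanSpace ℝ (Fin mx)) (xinf' : ℝ → EuclideanSpace ℝ (Fin mx))
    (uinf : ℝ → EuclideanSpace ℝ (Fin mu))
    (hxinf : ∀ t ∈ Set.Icc (0:ℝ) 1, HasDerivAt xinf (xinf' t) t)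
    (hxinf'c : ContinuousOn xinf' (Set.Icc 0 1))
    (huinfc : ContinuousOn uinf (Set.Icc 0 1))
    (hxconv : TendstoUniformlyOn x xinf atTop (Set.Icc 0 1))
    (hx'conv : TendstoUniformlyOn x' xinf' atTop (Set.Icc 0 1))
    (huconv : TendstoUniformlyOn u uinf atTop (Set.Icc 0 1))
    (δ : ℕ → ℝ) (hδ0 : ∀ n, 0 ≤ δ n) (hδ : Tendsto δ atTop (nhds 0))
    (hnode : ∀ n : ℕ, 1 ≤ n → ∀ k : ℕ, k ≤ n →
      ‖x' n ((k : ℝ) / n) - f (x n ((k : ℝ) / n)) (u n ((k : ℝ) / n))‖ ≤ δ n) :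
    ∀ t ∈ Set.Icc (0:ℝ) 1, xinf' t = f (xinf t) (uinf t) := by
  intro t ht
  set s : ℕ → ℝ := fun n => (⌊t * n⌋₊ : ℝ) / n
  have hk : ∀ n : ℕ, ⌊t * n⌋₊ ≤ n := fun n =>
    Nat.floor_le_of_le (mul_le_of_le_one_left n.cast_nonneg ht.2)
  have hst : Tendsto s atTop (nhdsWithin t (Set.Icc 0 1)) := by
    refine tendsto_nhdsWithin_iff.2
      ⟨(tendsto_nat_floor_mul_div_atTop ht.1).comp tendsto_natCast_atTop_atTop, ?_⟩
    exact Eventually.of_forall fun n =>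
      ⟨by positivity, div_le_one_of_le₀ (Nat.cast_le.2 (hk n)) n.cast_nonneg⟩
  have hxc : ContinuousOn xinf (Set.Icc 0 1) := fun t ht =>
    (hxinf t ht).continuousAt.continuousWithinAt
  have hxs := hxconv.tendsto_comp_of_continuousWithinAt (hxc t ht) hst
  have hx's := hx'conv.tendsto_comp_of_continuousWithinAt (hxinf'c t ht) hst
  have hus := huconv.tendsto_comp_of_continuousWithinAt (huinfc t ht) hst
  have hlim := hx's.sub ((hf.tendsto (xinf t, uinf t)).comp (hxs.prodMk_nhds hus))
  have hzero : Tendsto (fun n => x' n (s n) - f (x n (s n)) (u n (s n))) atTop (nhds 0) :=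
    squeeze_zero_norm' ((eventually_ge_atTop 1).mono fun n hn => hnode n hn _ (hk n)) hδ
  exact sub_eq_zero.1 (tendsto_nhds_unique hlim hzero)
end

section
/- Let m_x, m_u, m_h ≥ 1. Let h : ℝ^{m_x} × ℝ^{m_u} → ℝ^{m_h} satisfy ‖h(a,b) − h(a′,b′)‖ ≤ L_{hx} ‖a − a′‖ + L_{hu} ‖b − b′‖ for all arguments, with constants L_{hx}, L_{hu} ≥ 0. Let x, x̂ : [0,1] → ℝ^{m_x}, u, û : [0,1] → ℝ^{m_u}, and μ, μ̂ : [0,1] → ℝ^{m_h} satisfy, for all t ∈ [0,1]: the complementary slackness condition μ(t)ᵀ h(x(t), u(t)) = 0, the bounds ‖μ(t)‖ ≤ μ_max and ‖h(x̂(t), û(t))‖ ≤ h_max, and the approximation bounds ‖x̂(t) − x(t)‖ ≤ ε_x, ‖û(t) − u(t)‖ ≤ ε_u, ‖μ̂(t) − μ(t)‖ ≤ ε_μ, for nonnegative constants μ_max, h_max, ε_x, ε_u, ε_μ. Then for all t ∈ [0,1], |μ̂(t)ᵀ h(x̂(t), û(t))| ≤ ε_μ h_max + μ_max (L_{hx}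 ε_x + L_{hu} ε_u). -/
open scoped RealInnerProductSpace

/-- Approximants of a solution of the continuous first-order necessary conditions satisfy the
relaxed complementary slackness condition. -/
theorem approx_complementary_slackness (mx mu mh : ℕ) (hmx : 1 ≤ mx) (hmu : 1 ≤ mu)
    (hmh : 1 ≤ mh)
    (h : EuclideanSpace ℝ (Fin mx) → EuclideanSpace ℝ (Fin mu) → EuclideanSpace ℝ (Fin mh))
    (Lhx Lhu : ℝ) (hLhx : 0 ≤ Lhx) (hLhu : 0 ≤ Lhu)
    (hh : ∀ a a' b b', ‖h a b - h a' b'‖ ≤ Lhx * ‖a - a'‖ + Lhu * ‖b - b'‖)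
    (x xh : ℝ → EuclideanSpace ℝ (Fin mx)) (u uh : ℝ → EuclideanSpace ℝ (Fin mu))
    (μ μh : ℝ → EuclideanSpace ℝ (Fin mh))
    (hslack : ∀ t ∈ Set.Icc (0:ℝ) 1, ⟪μ t, h (x t) (u t)⟫ = 0)
    (μmax hmax εx εu εμ : ℝ) (hμmax : 0 ≤ μmax) (hhmax : 0 ≤ hmax)
    (hεx : 0 ≤ εx) (hεu : 0 ≤ εu) (hεμ : 0 ≤ εμ)
    (hbμ : ∀ t ∈ Set.Icc (0:ℝ) 1, ‖μ t‖ ≤ μmax)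
    (hbh : ∀ t ∈ Set.Icc (0:ℝ) 1, ‖h (xh t) (uh t)‖ ≤ hmax)
    (hbx : ∀ t ∈ Set.Icc (0:ℝ) 1, ‖xh t - x t‖ ≤ εx)
    (hbu : ∀ t ∈ Set.Icc (0:ℝ) 1, ‖uh t - u t‖ ≤ εu)
    (hbμ' : ∀ t ∈ Set.Icc (0:ℝ) 1, ‖μh t - μ t‖ ≤ εμ) :
    ∀ t ∈ Set.Icc (0:ℝ) 1,
      |⟪μh t, h (xh t) (uh t)⟫| ≤ εμ * hmax + μmax * (Lhx * εx + Lhu * εu) := by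
  intro t ht
  have hsplit : ⟪μh t, h (xh t) (uh t)⟫ =
      ⟪μh t - μ t, h (xh t) (uh t)⟫ + ⟪μ t, h (xh t) (uh t) - h (x t) (u t)⟫ := by
    rw [inner_sub_left, inner_sub_right, hslack t ht]
    ring
  have hlip : ‖h (xh t) (uh t) - h (x t) (u t)‖ ≤ Lhx * εx + Lhu * εu :=
    (hh _ _ _ _).trans <| add_le_add (mul_le_mul_of_nonneg_left (hbx t ht) hLhx)
      (mul_le_mul_of_nonneg_left (hbu t ht) hLhu)
  rw [hsplit]
  refine (abs_add_le _ _).trans (add_le_add ?_ ?_)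
  · exact (abs_real_inner_le_norm _ _).trans
      (mul_le_mul (hbμ' t ht) (hbh t ht) (norm_nonneg _) hεμ)
  · exact (abs_real_inner_le_norm _ _).trans
      (mul_le_mul (hbμ t ht) hlip (norm_nonneg _) hμmax)
end

section
/- Let m_x, m_u, m_h ≥ 1 and let h : ℝ^{m_x} × ℝ^{m_u} → ℝ^{m_h} be continuous. For each integer n ≥ 1, let x_n : [0,1] → ℝ^{m_x}, u_n : [0,1] → ℝ^{m_u}, and μ_n : [0,1] → ℝ^{m_h} be continuous, and suppose x_n → x^∞, u_n → u^∞, and μ_n → μ^∞ uniformly on [0,1], where x^∞, u^∞, μ^∞ are continuous. Suppose there are δ_n ≥ 0 with δ_n → 0 such that for every n ≥ 1 and every k ∈ {0, 1, …, n}: |μ_n(k/n)ᵀ h(x_n(k/n), u_n(k/n))| ≤ δ_n and every component of μ_n(k/n) is ≥ −δ_n. Then for every t ∈ [0,1]: μ^∞(t)ᵀ h(x^∞(t), u^∞(t)) = 0 and every component of μ^∞(t) is ≥ 0. -/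
open Filter
open scoped RealInnerProductSpace

/-- Dual consistency: the uniform limit of discrete dual solutions satisfying the relaxed
complementary slackness and dual feasibility conditions at the equidistant nodes `k/n`
satisfies the exact complementary slackness and nonnegativity conditions everywhere. -/
theorem limit_complementary_slackness (mx mu mh : ℕ) (hmx : 1 ≤ mx) (hmu : 1 ≤ mu)
    (hmh : 1 ≤ mh)
    (h : EuclideanSpace ℝ (Fin mx) → EuclideanSpace ℝ (Fin mu) → EuclideanSpace ℝ (Fin mh))
    (hh : Continuous fun q : EuclideanSpace ℝ (Fin mx) × EuclideanSpace ℝ (Fin mu) => h q.1 q.2)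
    (x : ℕ → ℝ → EuclideanSpace ℝ (Fin mx)) (u : ℕ → ℝ → EuclideanSpace ℝ (Fin mu))
    (μ : ℕ → ℝ → EuclideanSpace ℝ (Fin mh))
    (hxc : ∀ n : ℕ, 1 ≤ n → ContinuousOn (x n) (Set.Icc 0 1))
    (huc : ∀ n : ℕ, 1 ≤ n → ContinuousOn (u n) (Set.Icc 0 1))
    (hμc : ∀ n : ℕ, 1 ≤ n → ContinuousOn (μ n) (Set.Icc 0 1))
    (xinf : ℝ → EuclideanSpace ℝ (Fin mx)) (uinf : ℝ → EuclideanSpace ℝ (Fin mu))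
    (μinf : ℝ → EuclideanSpace ℝ (Fin mh))
    (hxinfc : ContinuousOn xinf (Set.Icc 0 1)) (huinfc : ContinuousOn uinf (Set.Icc 0 1))
    (hμinfc : ContinuousOn μinf (Set.Icc 0 1))
    (hxconv : TendstoUniformlyOn x xinf atTop (Set.Icc 0 1))
    (huconv : TendstoUniformlyOn u uinf atTop (Set.Icc 0 1))
    (hμconv : TendstoUniformlyOn μ μinf atTop (Set.Icc 0 1))
    (δ : ℕ → ℝ) (hδ0 : ∀ n, 0 ≤ δ n) (hδ : Tendsto δ atTop (nhds 0))
    (hslack : ∀ n : ℕ, 1 ≤ n → ∀ k : ℕ, k ≤ n →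
      |⟪μ n ((k : ℝ) / n), h (x n ((k : ℝ) / n)) (u n ((k : ℝ) / n))⟫| ≤ δ n)
    (hpos : ∀ n : ℕ, 1 ≤ n → ∀ k : ℕ, k ≤ n → ∀ i : Fin mh,
      μ n ((k : ℝ) / n) i ≥ -δ n) :
    ∀ t ∈ Set.Icc (0:ℝ) 1,
      ⟪μinf t, h (xinf t) (uinf t)⟫ = 0 ∧ ∀ i : Fin mh, 0 ≤ μinf t i := by
  intro t ht
  have hfloor (n : ℕ) : ⌊t * n⌋₊ ≤ n :=
    Nat.floor_le_of_le (mul_le_of_le_one_left n.cast_nonneg ht.2)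
  have hnode : Tendsto (fun n : ℕ => (⌊t * n⌋₊ : ℝ) / n) atTop (nhdsWithin t (Set.Icc 0 1)) :=
    tendsto_nhdsWithin_iff.2
      ⟨(tendsto_nat_floor_mul_div_atTop ht.1).comp tendsto_natCast_atTop_atTop,
        .of_forall fun n => ⟨by positivity,
          div_le_one_of_le₀ (by exact_mod_cast hfloor n) n.cast_nonneg⟩⟩
  have hx := hxconv.tendsto_comp (hxinfc t ht) hnode
  have hu := huconv.tendsto_comp (huinfc t ht) hnode
  have hμ := hμconv.tendsto_comp (hμinfc t ht) hnode
  have hprod := hμ.inner (𝕜 := ℝ) ((hh.tendsto (xinf t, uinf t)).comp (hx.prodMk_nhds hu))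
  refine ⟨tendsto_nhds_unique hprod (squeeze_zero_norm' ?_ hδ), fun i => ?_⟩
  · filter_upwards [eventually_ge_atTop 1] with n hn
    exact hslack n hn _ (hfloor n)
  · have hi := ((EuclideanSpace.proj (𝕜 := ℝ) i).continuous.tendsto (μinf t)).comp hμ
    refine le_of_tendsto_of_tendsto (by simpa using hδ.neg) hi ?_
    filter_upwards [eventually_ge_atTop 1] with n hn
    exact hpos n hn _ (hfloor n) i
end
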